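/- Let A ⊆ ℕ. Then A is dynamically thick if and only if there exist a robustly syndetic collection 𝒞 of subsets of ℕ and, for each B ∈ 𝒞, a thick set H_B ⊆ ℕ, such that A = ⋃_{B ∈ 𝒞} (B ∩ H_B). -/

import Mathlib

open Set

/-- `A − n` computed inside the positive integers. -/
def shiftN (A : Set ℕ+) (n : ℕ+) : Set ℕ+ := {m : ℕ+ | m + n ∈ A}

/-- `A − B := ⋃_{b ∈ B} (A − b)`. -/
def shiftSet (A B : Set ℕ+) : Set ℕ+ := ⋃ b ∈ B, shiftN A b

/-- A set of positive integers is syndetic if `A ∪ (A−1) ∪ ⋯ ∪ (A−N) = ℕ` for some `N`. -/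
def Syndetic (A : Set ℕ+) : Prop :=
  ∃ N : ℕ+, (A ∪ ⋃ k ∈ {k : ℕ+ | k ≤ N}, shiftN A k) = Set.univ

/-- A set of positive integers is thick if it contains a translate of every finite set. -/
def Thick (A : Set ℕ+) : Prop :=
  ∀ F : Finset ℕ+, ∃ n : ℕ+, ∀ f ∈ F, f + n ∈ A

/-- Piecewise syndetic: some finite union of translates `A ∪ (A−1) ∪ ⋯ ∪ (A−N)` is thick. -/
def PiecewiseSyndetic (A : Set ℕ+) : Prop :=
  ∃ N : ℕ+, Thick (A ∪ ⋃ k ∈ {k : ℕ+ | k ≤ N}, shiftN A k)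

/-- A self-map of a topological space is minimal if every forward orbit
`{T^n x | n ∈ ℕ, n ≥ 1}` is dense. -/
def MinimalMap {X : Type} [TopologicalSpace X] (T : X → X) : Prop :=
  ∀ x : X, Dense (Set.range fun n : ℕ+ => T^[(n : ℕ)] x)

/-- A minimal topological dynamical system: a nonempty compact metric space together with a
continuous map all of whose forward orbits are dense. -/
structure MinSystem : Type 1 where
  X : Type
  [met : MetricSpace X]
  [cpt : CompactSpace X]
  [nem : Nonempty X]
  T : X → X
  cont : Continuous T
  minimal : MinimalMap T

attribute [instance] MinSystem.met MinSystem.cpt MinSystem.nem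

/-- `R(x,U)`: the set of (positive) return times of `x` to `U`. -/
def retTimes {X : Type} (T : X → X) (x : X) (U : Set X) : Set ℕ+ :=
  {n : ℕ+ | T^[(n : ℕ)] x ∈ U}

/-- Dynamically syndetic sets. -/
def DynSyndetic (A : Set ℕ+) : Prop :=
  ∃ (S : MinSystem) (x : S.X) (U : Set S.X),
    IsOpen U ∧ U.Nonempty ∧ retTimes S.T x U ⊆ A

/-- Dynamically central syndetic sets. -/
def DynCentralSyndetic (A : Set ℕ+) : Prop :=
  ∃ (S : MinSystem) (x : S.X) (U : Set S.X),
    IsOpen U ∧ x ∈ U ∧ retTimes S.T x U ⊆ A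

/-- Dynamically thick sets: `{T^n x | n ∈ A}` is dense for every minimal system and point. -/
def DynThick (A : Set ℕ+) : Prop :=
  ∀ (S : MinSystem) (x : S.X), Dense ((fun n : ℕ+ => S.T^[(n : ℕ)] x) '' A)

/-- Sets of (minimal topological) pointwise recurrence. -/
def PointwiseRecurrent (A : Set ℕ+) : Prop :=
  ∀ (S : MinSystem) (x : S.X) (U : Set S.X), IsOpen U → x ∈ U →
    ∃ a ∈ A, S.T^[(a : ℕ)] x ∈ U

/-- A family: an upward-closed collection of subsets of the positive integers. -/
def UpwardClosed (F : Set (Set ℕ+)) : Prop :=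
  ∀ ⦃A B : Set ℕ+⦄, A ∈ F → A ⊆ B → B ∈ F

/-- A filter (in the combinatorial sense): an upward-closed collection closed under
finite intersections. -/
def IsFilterFamily (F : Set (Set ℕ+)) : Prop :=
  UpwardClosed F ∧ ∀ ⦃A B : Set ℕ+⦄, A ∈ F → B ∈ F → A ∩ B ∈ F

/-- A family all of whose members are syndetic. -/
def SyndeticFamily (F : Set (Set ℕ+)) : Prop := ∀ A ∈ F, Syndetic A

/-- `A − 𝔉 := {n | A − n ∈ 𝔉}`. -/
def famShift (A : Set ℕ+) (F : Set (Set ℕ+)) : Set ℕ+ := {n : ℕ+ | shiftN A n ∈ F}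

/-- `𝔉 + 𝔊 := {A | A − 𝔊 ∈ 𝔉}`. -/
def famSum (F G : Set (Set ℕ+)) : Set (Set ℕ+) := {A : Set ℕ+ | famShift A G ∈ F}

/-- A family is idempotent if `𝔉 ⊆ 𝔉 + 𝔉`. -/
def IdempotentFamily (F : Set (Set ℕ+)) : Prop := F ⊆ famSum F F

/-- A proper family: nonempty and not containing the empty set. -/
def ProperFamily (F : Set (Set ℕ+)) : Prop := F.Nonempty ∧ ∅ ∉ F

/-- A collection `𝒞` of subsets of `ℕ` is robustly syndetic if every dynamically syndetic
set has syndetic intersection with some member of `𝒞`. -/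
def RobustlySyndetic (C : Set (Set ℕ+)) : Prop :=
  ∀ A : Set ℕ+, DynSyndetic A → ∃ B ∈ C, Syndetic (A ∩ B)

/-- The elements of `A` are met in every window of length `g + 1`. -/
def HasGapBound (A : Set ℕ) (g : ℕ) : Prop := ∀ a, ∃ n, a ≤ n ∧ n ≤ a + g ∧ n ∈ A

/-- A finite 0-1 word (given by its length and its support) together with a bound on the gaps
between its occurrences. -/
structure GapWord where
  len : ℕ
  word : Set ℕ
  gap : ℕ

namespace GapWord

/-- The word `L` occurs in `Q` at position `s`, inside the interval `[a, b)`. -/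
def OccursIn (L : GapWord) (Q : Set ℕ) (a b s : ℕ) : Prop :=
  a ≤ s ∧ s + L.len ≤ b ∧ ∀ i < L.len, (s + i ∈ Q ↔ i ∈ L.word)

/-- From each point of `[a, b)` and from `a` itself the next occurrence of `L`, or the end `b`,
is near. -/
def FillGood (L : GapWord) (Q : Set ℕ) (a b : ℕ) : Prop :=
  (∀ t, a ≤ t → t < b →
    (∃ s, L.OccursIn Q a b s ∧ t ≤ s ∧ s ≤ t + (L.len + L.gap)) ∨ b ≤ t + (L.len + L.gap)) ∧
  ((∃ s, L.OccursIn Q a b s ∧ s ≤ a + L.gap) ∨ b ≤ a + L.gap)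

/-- From each point of `[a, b)` the next occurrence of `L` is near, up to the last `L.len` points. -/
def BlockGood (L : GapWord) (Q : Set ℕ) (a b : ℕ) : Prop :=
  ∀ t, a ≤ t → t < b →
    (∃ s, L.OccursIn Q a b s ∧ t ≤ s ∧ s ≤ t + (L.len + L.gap)) ∨ b ≤ t + L.len

variable {L : GapWord} {Q Q' : Set ℕ} {a b c d s : ℕ}

lemma OccursIn.mono (h : L.OccursIn Q a b s) (hc : c ≤ a) (hd : b ≤ d) : L.OccursIn Q c d s :=
  ⟨hc.trans h.1, h.2.1.trans hd, h.2.2⟩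

lemma OccursIn.congr (h : L.OccursIn Q a b s) (hQ : ∀ i, a ≤ i → i < b → (i ∈ Q' ↔ i ∈ Q)) :
    L.OccursIn Q' a b s :=
  ⟨h.1, h.2.1, fun i hi => (hQ _ (by have := h.1; omega) (by have := h.2.1; omega)).trans
    (h.2.2 i hi)⟩

lemma OccursIn.translate (h : L.OccursIn Q 0 b s)
    (hQ : ∀ i < b, (c + i ∈ Q' ↔ i ∈ Q)) : L.OccursIn Q' c (c + b) (c + s) :=
  ⟨by omega, by have := h.2.1; omega, fun i hi => by
    rw [add_assoc, hQ _ (by have := h.2.1; omega), h.2.2 i hi]⟩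

lemma FillGood.congr (h : L.FillGood Q a b) (hQ : ∀ i, a ≤ i → i < b → (i ∈ Q' ↔ i ∈ Q)) :
    L.FillGood Q' a b :=
  ⟨fun t ht ht' => (h.1 t ht ht').imp_left fun ⟨s, hs, hs'⟩ => ⟨s, hs.congr hQ, hs'⟩,
    h.2.imp_left fun ⟨s, hs, hs'⟩ => ⟨s, hs.congr hQ, hs'⟩⟩

lemma BlockGood.translate (h : L.BlockGood Q 0 b)
    (hQ : ∀ i < b, (c + i ∈ Q' ↔ i ∈ Q)) : L.BlockGood Q' c (c + b) := by
  intro t ht ht'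
  rcases h (t - c) (by omega) (by omega) with ⟨s, hs, h1, h2⟩ | h1
  · exact Or.inl ⟨c + s, hs.translate hQ, by omega, by omega⟩
  · exact Or.inr (by omega)

lemma fillGood_of_le (h : b ≤ a + L.gap) : L.FillGood Q a b :=
  ⟨fun _ _ _ => Or.inr (by omega), Or.inr h⟩

lemma BlockGood.append_fill (hab : a ≤ b) (hbc : b ≤ c) (h : L.BlockGood Q a b)
    (h' : L.FillGood Q b c) (t : ℕ) (ht : a ≤ t) (ht' : t < c) :
    (∃ s, L.OccursIn Q a c s ∧ t ≤ s ∧ s ≤ t + (L.len + L.gap)) ∨ c ≤ t + (L.len + L.gap) := by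
  by_cases htb : t < b
  · rcases h t ht htb with ⟨s, hs, h1, h2⟩ | h1
    · exact Or.inl ⟨s, hs.mono le_rfl hbc, h1, h2⟩
    · rcases h'.2 with ⟨s, hs, h2⟩ | h2
      · exact Or.inl ⟨s, hs.mono hab le_rfl, by have := hs.1; omega, by omega⟩
      · exact Or.inr (by omega)
  · rcases h'.1 t (by omega) ht' with ⟨s, hs, h1, h2⟩ | h1
    · exact Or.inl ⟨s, hs.mono hab le_rfl, h1, h2⟩
    · exact Or.inr h1

lemma FillGood.append (hab : a ≤ b) (hbc : b ≤ c) (hcd : c ≤ d) (h : L.FillGood Q a b)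
    (hb : L.BlockGood Q b c) (ho : L.OccursIn Q b c b) (h' : L.FillGood Q c d) :
    L.FillGood Q a d := by
  constructor
  · intro t ht ht'
    by_cases htb : t < b
    · rcases h.1 t ht htb with ⟨s, hs, h1, h2⟩ | h1
      · exact Or.inl ⟨s, hs.mono le_rfl (by omega), h1, h2⟩
      · exact Or.inl ⟨b, ho.mono hab hcd, by omega, h1⟩
    · rcases hb.append_fill hbc hcd h' t (by omega) ht' with ⟨s, hs, h1⟩ | h1
      · exact Or.inl ⟨s, hs.mono hab le_rfl, h1⟩
      · exact Or.inr h1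
  · rcases h.2 with ⟨s, hs, h1⟩ | h1
    · exact Or.inl ⟨s, hs.mono le_rfl (by omega), h1⟩
    · exact Or.inl ⟨b, ho.mono hab hcd, h1⟩

lemma BlockGood.append (hab : a ≤ b) (hbc : b ≤ c) (hcd : c ≤ d) (h : L.BlockGood Q a b)
    (h' : L.FillGood Q b c) (hb : L.BlockGood Q c d) (ho : L.OccursIn Q c d c) :
    L.BlockGood Q a d := by
  intro t ht ht'
  by_cases htc : t < c
  · rcases h.append_fill hab hbc h' t ht htc with ⟨s, hs, h1⟩ | h1
    · exact Or.inl ⟨s, hs.mono le_rfl hcd, h1⟩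
    · exact Or.inl ⟨c, ho.mono (by omega) le_rfl, by omega, h1⟩
  · rcases hb t (by omega) ht' with ⟨s, hs, h1⟩ | h1
    · exact Or.inl ⟨s, hs.mono (by omega) le_rfl, h1⟩
    · exact Or.inr h1

/-- A finite piece `W` of length `N` of a uniformly recurrent subset of `E`, in which the words
`Ls` occur with bounded gaps; every interval can be filled by a subset of `E` in the same way. -/
structure Stage (E : Set ℕ) (N : ℕ) (W : Set ℕ) (Ls : Set GapWord) : Prop where
  pos : 0 < N
  subset : W ⊆ E
  lt : ∀ i ∈ W, i < N
  occurs : ∀ L ∈ Ls, L.OccursIn W 0 N 0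
  block : ∀ L ∈ Ls, L.BlockGood W 0 N
  fill : ∀ a b, ∃ Q ⊆ E, (∀ i ∈ Q, a ≤ i ∧ i < b) ∧ ∀ L ∈ Ls, L.FillGood Q a b

variable {E W : Set ℕ} {N g : ℕ} {Ls : Set GapWord}

lemma Stage.fill_insert (h : Stage E N W Ls) (hg : HasGapBound {n | ∀ f ∈ W, n + f ∈ E} g)
    (a b : ℕ) : ∃ Q ⊆ E, (∀ i ∈ Q, a ≤ i ∧ i < b) ∧
      ∀ L ∈ insert ⟨N, W, N + g⟩ Ls, L.FillGood Q a b := by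
  induction hk : b - a using Nat.strong_induction_on generalizing a with
  | _ k ih =>
  obtain hle | hlt := le_or_gt b (a + (N + g))
  · obtain ⟨Q, hQE, hQ, hL⟩ := h.fill a b
    refine ⟨Q, hQE, hQ, ?_⟩
    rintro L (rfl | hmem)
    · exact fillGood_of_le hle
    · exact hL L hmem
  · obtain ⟨n, han, hng, hn⟩ := hg a
    have hpos := h.pos
    obtain ⟨Q₁, hQ₁E, hQ₁, hL₁⟩ := h.fill a n
    obtain ⟨Q₂, hQ₂E, hQ₂, hL₂⟩ := ih (b - (n + N)) (by omega) (n + N) rfl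
    have hW : ∀ i < N,
        (n + i ∈ {i | i ∈ Q₁ ∨ (∃ f ∈ W, i = n + f) ∨ i ∈ Q₂} ↔ i ∈ W) := by
      intro i hi
      constructor
      · rintro (h1 | ⟨f, hf, h1⟩ | h1)
        · have := hQ₁ _ h1; omega
        · rwa [Nat.add_left_cancel h1]
        · have := hQ₂ _ h1; omega
      · exact fun h1 => Or.inr (Or.inl ⟨i, h1, rfl⟩)
    refine ⟨{i | i ∈ Q₁ ∨ (∃ f ∈ W, i = n + f) ∨ i ∈ Q₂}, ?_, ?_, ?_⟩
    · rintro i (h1 | ⟨f, hf, rfl⟩ | h1)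
      exacts [hQ₁E h1, hn f hf, hQ₂E h1]
    · rintro i (h1 | ⟨f, hf, rfl⟩ | h1)
      · have := hQ₁ _ h1; omega
      · have := h.lt f hf; omega
      · have := hQ₂ _ h1; omega
    · intro L hmem
      have hF₁ : L.FillGood Q₁ a n := by
        rcases hmem with rfl | hmem
        · exact fillGood_of_le (by simp only; omega)
        · exact hL₁ L hmem
      have hB : L.BlockGood W 0 N ∧ L.OccursIn W 0 N 0 := by
        rcases hmem with rfl | hmem
        · exact ⟨fun t _ _ => Or.inr (by simp only; omega), le_rfl, by simp, by simp⟩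
        · exact ⟨h.block L hmem, h.occurs L hmem⟩
      refine FillGood.append (b := n) (c := n + N) (by omega) (by omega) (by omega)
        (hF₁.congr ?_) (hB.1.translate hW) (hB.2.translate hW) ((hL₂ L hmem).congr ?_)
      · intro i h1 h2
        constructor
        · rintro (h3 | ⟨f, hf, rfl⟩ | h3)
          · exact h3
          · omega
          · have := hQ₂ _ h3; omega
        · exact Or.inl
      · intro i h1 h2
        constructor
        · rintro (h3 | ⟨f, hf, rfl⟩ | h3)
          · have := hQ₁ _ h3; omega
          · have := h.lt f hf; omega
          · exact h3
        · exact fun h3 => Or.inr (Or.inr h3)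

lemma Stage.extend (h : Stage E N W Ls) (hg : HasGapBound {n | ∀ f ∈ W, n + f ∈ E} g) :
    ∃ N' W', N < N' ∧ (∀ i < N, (i ∈ W' ↔ i ∈ W)) ∧
      Stage E N' W' (insert ⟨N, W, N + g⟩ Ls) := by
  obtain ⟨n, hNn, hng, hn⟩ := hg N
  have hpos := h.pos
  obtain ⟨Q, hQE, hQ, hL⟩ := h.fill N n
  set W' : Set ℕ := {i | i ∈ W ∨ i ∈ Q ∨ ∃ f ∈ W, i = n + f} with hW'
  have hfst : ∀ i < N, (i ∈ W' ↔ i ∈ W) := by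
    intro i hi
    constructor
    · rintro (h1 | h1 | ⟨f, hf, h1⟩)
      · exact h1
      · have := hQ _ h1; omega
      · omega
    · exact Or.inl
  have hlst : ∀ i < N, (n + i ∈ W' ↔ i ∈ W) := by
    intro i hi
    constructor
    · rintro (h1 | h1 | ⟨f, hf, h1⟩)
      · have := h.lt _ h1; omega
      · have := hQ _ h1; omega
      · rwa [Nat.add_left_cancel h1]
    · exact fun h1 => Or.inr (Or.inr ⟨i, h1, rfl⟩)
  have hmid : ∀ i, N ≤ i → i < n → (i ∈ W' ↔ i ∈ Q) := by
    intro i h1 h2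
    constructor
    · rintro (h3 | h3 | ⟨f, hf, h3⟩)
      · have := h.lt _ h3; omega
      · exact h3
      · omega
    · exact fun h3 => Or.inr (Or.inl h3)
  have hB : ∀ L ∈ insert (⟨N, W, N + g⟩ : GapWord) Ls,
      L.BlockGood W 0 N ∧ L.OccursIn W 0 N 0 := by
    rintro L (rfl | hmem)
    · exact ⟨fun t _ _ => Or.inr (by simp only; omega), le_rfl, by simp, by simp⟩
    · exact ⟨h.block L hmem, h.occurs L hmem⟩
  refine ⟨n + N, W', by omega, hfst, by omega, ?_, ?_, ?_, ?_, h.fill_insert hg⟩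
  · rintro i (h1 | h1 | ⟨f, hf, rfl⟩)
    exacts [h.subset h1, hQE h1, hn f hf]
  · rintro i (h1 | h1 | ⟨f, hf, rfl⟩)
    · have := h.lt _ h1; omega
    · have := hQ _ h1; omega
    · have := h.lt f hf; omega
  · intro L hmem
    exact ((hB L hmem).2.congr fun i _ hi => hfst i hi).mono le_rfl (by omega)
  · intro L hmem
    have hF : L.FillGood Q N n := by
      rcases hmem with rfl | hmem
      · exact fillGood_of_le (by simp only; omega)
      · exact hL L hmem
    have h0 : L.BlockGood W' 0 (0 + N) := (hB L hmem).1.translate (by simpa using hfst)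
    rw [zero_add] at h0
    exact BlockGood.append (b := N) (c := n) (by omega) hNn (by omega) h0 (hF.congr hmid)
      ((hB L hmem).1.translate hlst) ((hB L hmem).2.translate hlst)

end GapWord

/-- Every prefix of `Z` recurs with bounded gaps. -/
def UniformlyRecurrentSet (Z : Set ℕ) : Prop :=
  ∀ K, ∃ M, HasGapBound {s | ∀ i < K, (s + i ∈ Z ↔ i ∈ Z)} M

open GapWord in
/-- If the intersections of finitely many shifts `E - f`, `f ∈ E`, have bounded gaps, then every
point of `E` lies in a uniformly recurrent subset of `E`. -/
lemma exists_uniformlyRecurrentSet {E : Set ℕ}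
    (hE : ∀ W ⊆ E, W.Finite → ∃ g, HasGapBound {n | ∀ f ∈ W, n + f ∈ E} g) {k : ℕ} (hk : k ∈ E) :
    ∃ Z ⊆ E, k ∈ Z ∧ UniformlyRecurrentSet Z := by
  let σ := {p : ℕ × Set ℕ × Set GapWord // Stage E p.1 p.2.1 p.2.2}
  have step : ∀ p : σ, ∃ q : σ, p.1.1 < q.1.1 ∧
      (∀ i < p.1.1, (i ∈ q.1.2.1 ↔ i ∈ p.1.2.1)) ∧ p.1.2.2 ⊆ q.1.2.2 ∧
      ∃ L ∈ q.1.2.2, L.len = p.1.1 ∧ L.word = p.1.2.1 := by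
    rintro ⟨⟨N, W, Ls⟩, h⟩
    obtain ⟨g, hg⟩ := hE W h.subset ((Set.finite_lt_nat N).subset h.lt)
    obtain ⟨N', W', hN, hW, h'⟩ := h.extend hg
    exact ⟨⟨⟨N', W', _⟩, h'⟩, hN, hW, Set.subset_insert _ _, _, Set.mem_insert _ _, rfl, rfl⟩
  have start : Stage E (k + 1) {k} ∅ :=
    ⟨by omega, by simpa using hk, by simp, by simp, by simp,
      fun a b => ⟨∅, by simp, by simp, by simp⟩⟩
  choose next hlen hpre hsub hnew using step
  let u : ℕ → σ := fun n => next^[n] ⟨⟨k + 1, {k}, ∅⟩, start⟩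
  have hu : ∀ n, u (n + 1) = next (u n) := fun n => Function.iterate_succ_apply' _ _ _
  have hmono : StrictMono fun n => (u n).1.1 :=
    strictMono_nat_of_lt_succ fun n => by rw [hu]; exact hlen _
  have hagree : ∀ n m, n ≤ m → ∀ i < (u n).1.1, (i ∈ (u m).1.2.1 ↔ i ∈ (u n).1.2.1) := by
    intro n m hnm
    induction m, hnm using Nat.le_induction with
    | base => exact fun _ _ => Iff.rfl
    | succ m hnm ih =>
      intro i hi
      rw [hu, hpre _ _ (hi.trans_le (hmono.monotone hnm)), ih i hi]
  have hLs : Monotone fun n => (u n).1.2.2 :=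
    monotone_nat_of_le_succ fun n => by rw [hu]; exact hsub _
  have hZ : ∀ n, ∀ i < (u n).1.1, ((∃ m, i ∈ (u m).1.2.1) ↔ i ∈ (u n).1.2.1) := by
    intro n i hi
    refine ⟨fun ⟨m, hm⟩ => ?_, fun h => ⟨n, h⟩⟩
    rcases le_total n m with h | h
    · exact (hagree n m h i hi).1 hm
    · exact (hagree m n h i ((u m).2.lt i hm)).2 hm
  refine ⟨{i | ∃ m, i ∈ (u m).1.2.1}, fun i ⟨m, hm⟩ => (u m).2.subset hm, ⟨0, rfl⟩, ?_⟩
  intro K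
  obtain ⟨L, hL, hLlen, hLword⟩ := hnew (u K)
  rw [← hu] at hL
  refine ⟨L.len + L.gap, fun a => ?_⟩
  have hK : K ≤ L.len := hLlen ▸ hmono.id_le K
  set n := K + 1 + (a + L.len + L.gap + 1) with hn
  have hNn : n ≤ (u n).1.1 := hmono.id_le n
  have hLn : L ∈ (u n).1.2.2 := hLs (by omega : K + 1 ≤ n) hL
  rcases (u n).2.block L hLn a (by omega) (by omega) with ⟨s, hs, h1, h2⟩ | h1
  · refine ⟨s, h1, h2, fun i hi => ?_⟩
    have := hs.2.1
    simp only [Set.mem_ofPred_eq]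
    rw [hZ n (s + i) (by omega), hs.2.2 i (by omega), hLword, hZ K i (by omega)]
  · omega

/-- The left shift on 0-1 sequences. -/
def boolShift (w : ℕ → Bool) : ℕ → Bool := fun n => w (n + 1)

lemma boolShift_iterate (w : ℕ → Bool) (m n : ℕ) : boolShift^[m] w n = w (n + m) := by
  induction m generalizing n with
  | zero => rfl
  | succ m ih => rw [Function.iterate_succ_apply', boolShift, ih]; congr 1; omega

lemma continuous_boolShift : Continuous boolShift :=
  continuous_pi fun n => continuous_apply (n + 1)

/-- The orbit closure of a 0-1 sequence under the shift. -/
def orbitClosure (z : ℕ → Bool) : Set (ℕ → Bool) :=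
  closure (Set.range fun m : ℕ => boolShift^[m] z)

lemma iterate_mem_orbitClosure (z : ℕ → Bool) (m : ℕ) : boolShift^[m] z ∈ orbitClosure z :=
  subset_closure ⟨m, rfl⟩

lemma mapsTo_orbitClosure (z : ℕ → Bool) :
    Set.MapsTo boolShift (orbitClosure z) (orbitClosure z) := by
  refine Set.MapsTo.closure ?_ continuous_boolShift
  rintro _ ⟨m, rfl⟩
  exact ⟨m + 1, Function.iterate_succ_apply' _ _ _⟩

lemma iterate_restrict_orbitClosure (z : ℕ → Bool) (y : orbitClosure z) (n : ℕ) :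
    (((mapsTo_orbitClosure z).restrict boolShift _ _)^[n] y : ℕ → Bool) =
      boolShift^[n] (y : ℕ → Bool) := by
  induction n with
  | zero => rfl
  | succ n ih => rw [Function.iterate_succ_apply', Function.iterate_succ_apply', ← ih]; rfl

/-- Every nonempty open subset of the orbit closure contains the trace of a cylinder around a
point of the orbit. -/
lemma exists_cylinder_subset {z : ℕ → Bool} {O : Set (ℕ → Bool)} (hO : IsOpen O)
    (h : (orbitClosure z ∩ O).Nonempty) :
    ∃ m K, PiNat.cylinder (boolShift^[m] z) K ⊆ O := by
  obtain ⟨y, hy, hyO⟩ := h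
  obtain ⟨w, hwO, m, rfl⟩ := mem_closure_iff.1 hy O hO hyO
  obtain ⟨_, ⟨v, K, rfl⟩, hmem, hsub⟩ :=
    (PiNat.isTopologicalBasis_cylinders fun _ => Bool).exists_subset_of_mem_open hwO hO
  exact ⟨m, K, (PiNat.mem_cylinder_iff_eq.1 hmem).symm ▸ hsub⟩

open Classical in
lemma minimalMap_orbitClosure {Z : Set ℕ} (hZ : UniformlyRecurrentSet Z) :
    MinimalMap ((mapsTo_orbitClosure fun n => decide (n ∈ Z)).restrict boolShift _ _) := by
  intro y
  rw [dense_iff_inter_open]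
  rintro _ ⟨O, hO, rfl⟩ ⟨x, hx⟩
  obtain ⟨m, K, hK⟩ := exists_cylinder_subset hO ⟨x, x.2, hx⟩
  obtain ⟨M, hM⟩ := hZ (m + K)
  obtain ⟨w, hw, t, rfl⟩ := mem_closure_iff.1 y.2 (PiNat.cylinder y.1 (1 + M + m + K))
    (PiNat.isOpen_cylinder _ _ _) (PiNat.self_mem_cylinder _ _)
  obtain ⟨s, hts, hsM, hs⟩ := hM (t + 1)
  refine ⟨_, ?_, ⟨⟨s - t + m, by omega⟩, rfl⟩⟩
  simp only [Set.mem_preimage, PNat.mk_coe, iterate_restrict_orbitClosure]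
  refine hK (PiNat.mem_cylinder_iff.2 fun i hi => ?_)
  have h : boolShift^[t] _ _ = _ := PiNat.mem_cylinder_iff.1 hw (i + (s - t + m)) (by omega)
  rw [boolShift_iterate, boolShift_iterate, ← h, boolShift_iterate]
  rw [show i + (s - t + m) + t = s + (i + m) by omega, decide_eq_decide]
  exact hs (i + m) (by omega)

open Classical in
/-- A dynamically thick set meets every uniformly recurrent set with a positive element. -/
lemma DynThick.exists_mem_uniformlyRecurrentSet {A : Set ℕ+} (hA : DynThick A) {Z : Set ℕ}
    (hZ : UniformlyRecurrentSet Z) {k : ℕ} (hk : k ∈ Z) : ∃ n ∈ A, (n : ℕ) ∈ Z := by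
  let z : ℕ → Bool := fun n => decide (n ∈ Z)
  let _ : MetricSpace (orbitClosure z) := TopologicalSpace.metrizableSpaceMetric _
  have : CompactSpace (orbitClosure z) := isCompact_iff_compactSpace.1 isClosed_closure.isCompact
  let z₀ : orbitClosure z := ⟨z, iterate_mem_orbitClosure z 0⟩
  have : Nonempty (orbitClosure z) := ⟨z₀⟩
  let S : MinSystem :=
    { X := orbitClosure z
      T := (mapsTo_orbitClosure z).restrict boolShift _ _
      cont := continuous_boolShift.restrict _
      minimal := minimalMap_orbitClosure hZ }
  have hO : IsOpen {w : orbitClosure z | w.1 0 = true} :=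
    (isOpen_discrete ({true} : Set Bool)).preimage (
      f := fun w : orbitClosure z => w.1 0) ((continuous_apply 0).comp continuous_subtype_val)
  obtain ⟨_, hw, n, hn, rfl⟩ := dense_iff_inter_open.1 (hA S z₀) _ hO
    ⟨⟨_, iterate_mem_orbitClosure z k⟩, by
      change boolShift^[k] z 0 = true
      simpa [boolShift_iterate, z] using hk⟩
  refine ⟨n, hn, ?_⟩
  have hw' : (S.T^[(n : ℕ)] z₀).1 0 = true := hw
  have hi : (S.T^[(n : ℕ)] z₀).1 = boolShift^[(n : ℕ)] z := iterate_restrict_orbitClosure z z₀ n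
  rw [hi, boolShift_iterate] at hw'
  simpa [z] using hw'

/-- A subset of `ℕ+` as a set of natural numbers. -/
def natSet (A : Set ℕ+) : Set ℕ := {n | ∃ m ∈ A, (m : ℕ) = n}

@[simp] lemma coe_mem_natSet {A : Set ℕ+} {n : ℕ+} : (n : ℕ) ∈ natSet A ↔ n ∈ A :=
  ⟨fun ⟨_, h, h'⟩ => PNat.eq h' ▸ h, fun h => ⟨n, h, rfl⟩⟩

lemma syndetic_iff {A : Set ℕ+} : Syndetic A ↔ ∃ g, HasGapBound (natSet A) g := by
  constructor
  · rintro ⟨N, hN⟩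
    refine ⟨N + 1, fun a => ?_⟩
    have h : a.succPNat ∈ A ∪ ⋃ k ∈ {k : ℕ+ | k ≤ N}, shiftN A k := hN ▸ Set.mem_univ _
    simp only [Set.mem_union, Set.mem_iUnion] at h
    rcases h with h | ⟨k, hk, h⟩
    · exact ⟨a + 1, by omega, by omega, _, h, rfl⟩
    · have hk' : (k : ℕ) ≤ N := hk
      exact ⟨a + 1 + k, by omega, by omega, _, h, rfl⟩
  · rintro ⟨g, hg⟩
    refine ⟨g.succPNat, Set.eq_univ_of_forall fun m => ?_⟩
    obtain ⟨_, hmn, hng, n, hn, rfl⟩ := hg m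
    rcases hmn.eq_or_lt with h | h
    · exact Or.inl (PNat.eq h ▸ hn)
    · have hlt : m < n := h
      refine Or.inr (Set.mem_biUnion (x := n - m) ?_ ?_)
      · rw [Set.mem_ofPred_eq, ← PNat.coe_le_coe, PNat.sub_coe, if_pos hlt, Nat.succPNat_coe]
        omega
      · change m + (n - m) ∈ A
        rwa [PNat.add_sub_of_lt hlt]

/-- The return times to a nonempty open set in a minimal system have bounded gaps. -/
lemma MinSystem.exists_hasGapBound (S : MinSystem) (x : S.X) {U : Set S.X} (hU : IsOpen U)
    (hne : U.Nonempty) : ∃ g, HasGapBound {n | S.T^[n] x ∈ U} g := by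
  obtain ⟨F, hF⟩ := isCompact_univ.elim_finite_subcover
    (fun n : ℕ+ => S.T^[(n : ℕ)] ⁻¹' U) (fun n => hU.preimage (S.cont.iterate n)) (by
      intro y _
      obtain ⟨_, hw, n, rfl⟩ := dense_iff_inter_open.1 (S.minimal y) U hU hne
      exact Set.mem_iUnion.2 ⟨n, hw⟩)
  refine ⟨F.sup fun n : ℕ+ => (n : ℕ), fun a => ?_⟩
  obtain ⟨n, hn, h⟩ := Set.mem_iUnion₂.1 (hF (Set.mem_univ (S.T^[a] x)))
  refine ⟨n + a, by omega, ?_, ?_⟩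
  · have : (n : ℕ) ≤ _ := Finset.le_sup (f := fun n : ℕ+ => (n : ℕ)) hn
    omega
  · simpa [Function.iterate_add_apply] using h

/-- Some bounded thickening of `D` contains arbitrarily long intervals. -/
def PiecewiseGapBound (D : Set ℕ) (N : ℕ) : Prop :=
  ∀ l, ∃ a, ∀ t, a ≤ t → t ≤ a + l → ∃ n, t ≤ n ∧ n ≤ t + N ∧ n ∈ D

lemma HasGapBound.diff {S D : Set ℕ} {g : ℕ} (hS : HasGapBound S g)
    (hD : ¬ ∃ N, PiecewiseGapBound D N) : ∃ g', HasGapBound (S \ D) g' := by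
  by_contra! hcon
  refine hD ⟨g, fun l => ?_⟩
  have := hcon (l + g)
  simp only [HasGapBound, not_forall, not_exists, not_and] at this
  obtain ⟨a, ha⟩ := this
  refine ⟨a, fun t hat htl => ?_⟩
  obtain ⟨n, htn, hng, hn⟩ := hS t
  exact ⟨n, htn, hng, by_contra fun hnD => ha n (by omega) (by omega) ⟨hn, hnD⟩⟩

lemma PiecewiseGapBound.of_shift {D : Set ℕ} {N f : ℕ}
    (h : PiecewiseGapBound {n | n + f ∈ D} N) : PiecewiseGapBound D N := by
  intro l
  obtain ⟨a, ha⟩ := h l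
  refine ⟨a + f, fun t hat htl => ?_⟩
  obtain ⟨n, h1, h2, h3⟩ := ha (t - f) (by omega) (by omega)
  exact ⟨n + f, by omega, by omega, h3⟩

lemma HasGapBound.exists_diff_shifts {S D W : Set ℕ} {g : ℕ} (hS : HasGapBound S g)
    (hD : ¬ ∃ N, PiecewiseGapBound D N) (hW : W.Finite) :
    ∃ g', HasGapBound {n | n ∈ S ∧ ∀ f ∈ W, n + f ∉ D} g' := by
  induction W, hW using Set.Finite.induction_on with
  | empty => exact ⟨g, by simpa using hS⟩
  | @insert f W _ _ ih =>
    obtain ⟨g₁, h₁⟩ := ih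
    obtain ⟨g₂, h₂⟩ := h₁.diff (D := {n | n + f ∈ D}) fun ⟨N, hN⟩ => hD ⟨N, hN.of_shift⟩
    refine ⟨g₂, fun a => ?_⟩
    obtain ⟨n, han, hng, ⟨hnS, hnW⟩, hnf⟩ := h₂ a
    exact ⟨n, han, hng, hnS, Set.forall_mem_insert.2 ⟨hnf, hnW⟩⟩

/-- A dynamically thick set is piecewise syndetic along the return times of a minimal system. -/
lemma DynThick.exists_piecewiseGapBound {A : Set ℕ+} (hA : DynThick A) (S : MinSystem) (x : S.X)
    {U : Set S.X} (hU : IsOpen U) (hne : U.Nonempty) :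
    ∃ N, PiecewiseGapBound (natSet (A ∩ retTimes S.T x U)) N := by
  by_contra hD
  set D := natSet (A ∩ retTimes S.T x U) with hDdef
  let E : Set ℕ := {n | 0 < n ∧ S.T^[n] x ∈ U ∧ n ∉ D}
  have hE : ∀ W ⊆ E, W.Finite → ∃ g, HasGapBound {n | ∀ f ∈ W, n + f ∈ E} g := by
    intro W hWE hW
    obtain ⟨g, hg⟩ := S.exists_hasGapBound x (U := ⋂ f ∈ W, S.T^[f] ⁻¹' U)
      (hW.isOpen_biInter fun f _ => hU.preimage (S.cont.iterate f))
      ⟨x, Set.mem_iInter₂.2 fun f hf => (hWE hf).2.1⟩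
    obtain ⟨g', hg'⟩ := hg.exists_diff_shifts hD hW
    refine ⟨g', fun a => ?_⟩
    obtain ⟨n, han, hng, hnU, hnD⟩ := hg' a
    refine ⟨n, han, hng, fun f hf => ⟨?_, ?_, hnD f hf⟩⟩
    · have := (hWE hf).1
      omega
    · rw [add_comm, Function.iterate_add_apply]
      exact Set.mem_iInter₂.1 hnU f hf
  obtain ⟨g, hg⟩ := S.exists_hasGapBound x hU hne
  obtain ⟨g', hg'⟩ := hg.diff hD
  obtain ⟨k, hk, -, hkU, hkD⟩ := hg' 1
  obtain ⟨Z, hZE, hkZ, hZ⟩ := exists_uniformlyRecurrentSet hE (k := k) ⟨hk, hkU, hkD⟩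
  obtain ⟨n, hnA, hnZ⟩ := hA.exists_mem_uniformlyRecurrentSet hZ hkZ
  obtain ⟨-, hnU, hnD⟩ := hZE hnZ
  exact hnD (coe_mem_natSet.2 ⟨hnA, hnU⟩)

/-- A dynamically syndetic set contains a syndetic set whose intersection with some thick set
lies in the given dynamically thick set. -/
lemma DynThick.exists_syndetic_inter_thick {A R : Set ℕ+} (hA : DynThick A) (hR : DynSyndetic R) :
    ∃ B H, Syndetic (R ∩ B) ∧ Thick H ∧ B ∩ H ⊆ A := by
  obtain ⟨S, x, U, hU, hne, hsub⟩ := hR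
  obtain ⟨N, hN⟩ := hA.exists_piecewiseGapBound S x hU hne
  obtain ⟨g, hg⟩ := S.exists_hasGapBound x hU hne
  set D := A ∩ retTimes S.T x U
  let H : Set ℕ+ := {t | ∃ n, (t : ℕ) ≤ n ∧ n ≤ t + N ∧ n ∈ natSet D}
  refine ⟨D ∪ (retTimes S.T x U \ H), H, ?_, ?_, ?_⟩
  · refine syndetic_iff.2 ⟨1 + g + N, fun a => ?_⟩
    obtain ⟨n, han, hng, hn⟩ := hg (a + 1)
    lift n to ℕ+ using by omega
    by_cases hnH : n ∈ H
    · obtain ⟨_, hnm, hmN, m, hm, rfl⟩ := hnH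
      exact ⟨m, by omega, by omega, m, ⟨hsub hm.2, Or.inl hm⟩, rfl⟩
    · exact ⟨n, by omega, by omega, n, ⟨hsub hn, Or.inr ⟨hn, hnH⟩⟩, rfl⟩
  · intro F
    obtain ⟨a, ha⟩ := hN (F.sup (fun f : ℕ+ => (f : ℕ)) + 1)
    refine ⟨a.succPNat, fun f hf => ha _ ?_ ?_⟩
    · rw [PNat.add_coe, Nat.succPNat_coe]
      omega
    · have : (f : ℕ) ≤ _ := Finset.le_sup (f := fun n : ℕ+ => (n : ℕ)) hf
      rw [PNat.add_coe, Nat.succPNat_coe]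
      omega
  · rintro n ⟨h | h, hH⟩
    exacts [h.1, absurd hH h.2]

lemma Thick.inter_nonempty {H A : Set ℕ+} (hH : Thick H) (hA : Syndetic A) :
    (A ∩ H).Nonempty := by
  obtain ⟨g, hg⟩ := syndetic_iff.1 hA
  obtain ⟨n, hn⟩ := hH (Finset.Icc 1 g.succPNat)
  obtain ⟨_, hnm, hmg, m, hm, rfl⟩ := hg (n + 1)
  have hlt : n < m := hnm
  have hmem : m - n ∈ Finset.Icc 1 g.succPNat := by
    rw [Finset.mem_Icc, ← PNat.coe_le_coe (m - n), PNat.sub_coe, if_pos hlt, Nat.succPNat_coe]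
    exact ⟨one_le, by omega⟩
  have := hn _ hmem
  rw [add_comm, PNat.add_sub_of_lt hlt] at this
  exact ⟨m, hm, this⟩

lemma thick_univ : Thick Set.univ := fun _ => ⟨1, fun _ _ => Set.mem_univ _⟩

/-- **Theorem E.** A set `A ⊆ ℕ` is dynamically thick if and only if there are a robustly
syndetic collection `𝒞` and, for each `B ∈ 𝒞`, a thick set `H_B`, such that
`A = ⋃_{B ∈ 𝒞} (B ∩ H_B)`. -/
theorem dynThick_structure (A : Set ℕ+) :
    DynThick A ↔
      ∃ (C : Set (Set ℕ+)) (H : Set ℕ+ → Set ℕ+),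
        RobustlySyndetic C ∧ (∀ B ∈ C, Thick (H B)) ∧
        A = ⋃ B ∈ C, (B ∩ H B) := by
  classical
  constructor
  · intro hA
    let C : Set (Set ℕ+) := {B | ∃ H, Thick H ∧ B ∩ H ⊆ A}
    let H : Set ℕ+ → Set ℕ+ := fun B =>
      if B ⊆ A then Set.univ else if h : B ∈ C then h.choose else ∅
    have hH : ∀ B ∈ C, Thick (H B) ∧ B ∩ H B ⊆ A := by
      intro B hB
      by_cases hBA : B ⊆ A
      · simpa [H, hBA] using thick_univ
      · simpa only [H, if_neg hBA, dif_pos hB] using hB.choose_spec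
    refine ⟨C, H, ?_, fun B hB => (hH B hB).1, ?_⟩
    · intro R hR
      obtain ⟨B, H', hB, hH', hBH⟩ := hA.exists_syndetic_inter_thick hR
      exact ⟨B, ⟨H', hH', hBH⟩, hB⟩
    · refine Set.Subset.antisymm (fun a ha => ?_) (Set.iUnion₂_subset fun B hB => (hH B hB).2)
      have hAC : A ∈ C := ⟨Set.univ, thick_univ, Set.inter_subset_left⟩
      exact Set.mem_biUnion hAC ⟨ha, by simp [H]⟩
  · rintro ⟨C, H, hC, hH, rfl⟩ S x
    rw [dense_iff_inter_open]
    intro U hU hne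
    obtain ⟨B, hB, hsynd⟩ := hC (retTimes S.T x U) ⟨S, x, U, hU, hne, subset_rfl⟩
    obtain ⟨n, ⟨hnU, hnB⟩, hnH⟩ := (hH B hB).inter_nonempty hsynd
    exact ⟨_, hnU, n, Set.mem_biUnion hB ⟨hnB, hnH⟩, rfl⟩
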